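/- Let a, b > 0 satisfy the nine inequalities 2a + b ≥ 1, 3a + 4b ≥ 2, 9a + 11b ≥ 6, a + 5b ≥ 1, 4a + 9b ≥ 3, 10a + 16b ≥ 7, 13a + 20b ≥ 8, 5a + 14b ≥ 4, a + (3/2)b ≥ 2/3. Let G be a graph with no triangle adjacent to a 4-cycle such that α(G) < |V(G)| − (a|V(G)| + b|E(G)| + bλ(G)), and suppose every graph G' with fewer vertices than G and no triangle adjacent to a 4-cycle satisfies α(G') ≥ |V(G')| − (a|V(G')| + b|E(G')| + bλ(G')). Then every induced subgraph H of G isomorphic to a 2-chain of triangles satisfies Φ(H) ≥ 4, where Φ(H) is the number of edges of G with exactly one endpoint in V(H). -/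

import Mathlib

namespace Paper

/-- `s` is an independent set in the simple graph `G`. -/
def IsIndepSet {V : Type} (G : SimpleGraph V) (s : Finset V) : Prop :=
  ∀ v ∈ s, ∀ w ∈ s, ¬ G.Adj v w

/-- The independence number `α(G)`: the size of a largest independent set. -/
noncomputable def indepNum {V : Type} (G : SimpleGraph V) : ℕ :=
  sSup {n | ∃ s : Finset V, IsIndepSet G s ∧ s.card = n}

/-- The number of edges `|E(G)|`. -/
noncomputable def numEdges {V : Type} (G : SimpleGraph V) : ℕ :=
  Nat.card G.edgeSet

/-- The degree of a vertex. -/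
noncomputable def deg {V : Type} (G : SimpleGraph V) (v : V) : ℕ :=
  Nat.card (G.neighborSet v)

/-- `G` contains a triangle sharing a common edge with a 4-cycle:
the triangle `u v w` and the 4-cycle `u v x y` share the edge `u v`. -/
def HasTriangleAdjC4 {V : Type} (G : SimpleGraph V) : Prop :=
  ∃ u v w x y : V, G.Adj u v ∧ G.Adj v w ∧ G.Adj w u ∧
    G.Adj v x ∧ G.Adj x y ∧ G.Adj y u ∧ u ≠ x ∧ v ≠ y

/-- `G` contains two triangles sharing a common edge:
the triangles `u v w` and `u v x` share the edge `u v`. -/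
def HasAdjTriangles {V : Type} (G : SimpleGraph V) : Prop :=
  ∃ u v w x : V, G.Adj u v ∧ G.Adj v w ∧ G.Adj w u ∧
    G.Adj v x ∧ G.Adj x u ∧ w ≠ x

/-- `G` contains a triangle sharing a common edge with a 5-cycle:
the triangle `u v w` and the 5-cycle `u v x y z` share the edge `u v`. -/
def HasTriangleAdjC5 {V : Type} (G : SimpleGraph V) : Prop :=
  ∃ u v w x y z : V, G.Adj u v ∧ G.Adj v w ∧ G.Adj w u ∧
    G.Adj v x ∧ G.Adj x y ∧ G.Adj y z ∧ G.Adj z u ∧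
    u ≠ x ∧ u ≠ y ∧ v ≠ y ∧ v ≠ z ∧ x ≠ z

/-- The 2-chain of triangles: two disjoint triangles `{0,1,2}` and `{3,4,5}`
joined by the single edge `{2,3}` (6 vertices, 7 edges). -/
def chainGraph : SimpleGraph (Fin 6) :=
  SimpleGraph.fromRel (fun i j =>
    (i.val, j.val) ∈ [(0,1), (0,2), (1,2), (3,4), (3,5), (4,5), (2,3)])

/-- A connected component is difficult if it is a triangle or a 2-chain of triangles. -/
def IsDifficult {V : Type} (G : SimpleGraph V) (c : G.ConnectedComponent) : Prop :=
  Nonempty (SimpleGraph.induce c.supp G ≃g (⊤ : SimpleGraph (Fin 3))) ∨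
  Nonempty (SimpleGraph.induce c.supp G ≃g chainGraph)

/-- `λ(G)`: the number of difficult components of `G`. -/
noncomputable def lambda {V : Type} (G : SimpleGraph V) : ℕ :=
  Nat.card {c : G.ConnectedComponent // IsDifficult G c}

/-- `Φ(S)`: the number of edges of `G` with exactly one endpoint in `S`. -/
noncomputable def phi {V : Type} (G : SimpleGraph V) (S : Set V) : ℕ :=
  Nat.card {e : Sym2 V | e ∈ G.edgeSet ∧ ∃ x ∈ S, ∃ y, y ∉ S ∧ e = s(x, y)}

instance : DecidableRel chainGraph.Adj := fun i j => by
  unfold chainGraph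
  rw [SimpleGraph.fromRel_adj]
  infer_instance

lemma numEdges_chainGraph : numEdges chainGraph = 7 := by
  rw [numEdges, Nat.card_eq_fintype_card]
  decide +kernel

lemma numEdges_top_fin_three : numEdges (⊤ : SimpleGraph (Fin 3)) = 3 := by
  rw [numEdges, Nat.card_eq_fintype_card]
  decide +kernel

section General

variable {V : Type}

lemma card_le_indepNum [Finite V] {G : SimpleGraph V} {s : Finset V} (hs : IsIndepSet G s) :
    s.card ≤ indepNum G := by
  have := Fintype.ofFinite V
  refine le_csSup ⟨Fintype.card V, ?_⟩ ⟨s, hs, rfl⟩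
  rintro n ⟨t, -, rfl⟩
  exact t.card_le_univ

lemma exists_isIndepSet_card [Finite V] (G : SimpleGraph V) :
    ∃ s : Finset V, IsIndepSet G s ∧ s.card = indepNum G := by
  have := Fintype.ofFinite V
  refine Nat.sSup_mem (s := {n | ∃ s : Finset V, IsIndepSet G s ∧ s.card = n})
    ⟨0, ∅, by simp [IsIndepSet], rfl⟩ ⟨Fintype.card V, ?_⟩
  rintro n ⟨t, -, rfl⟩
  exact t.card_le_univ

/-- An independent set of `G - S` extends by any independent subset of `S` without neighbours
outside `S`. -/
lemma indepNum_compl_add_card_le [Finite V] {G : SimpleGraph V} {S : Set V} {T : Finset V}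
    (hT : IsIndepSet G T) (hTS : ∀ x ∈ T, x ∈ S) (hout : ∀ x ∈ T, ∀ y, G.Adj x y → y ∈ S) :
    indepNum (G.induce Sᶜ) + T.card ≤ indepNum G := by
  classical
  obtain ⟨I, hI, hcard⟩ := exists_isIndepSet_card (G.induce Sᶜ)
  set J : Finset V := I.map (Function.Embedding.subtype _) with hJ
  have hJS : ∀ x ∈ J, x ∉ S := by
    intro x hx
    obtain ⟨y, -, rfl⟩ := Finset.mem_map.1 hx
    exact y.2
  have hdisj : Disjoint J T := Finset.disjoint_left.2 fun x hx hxT => hJS x hx (hTS x hxT)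
  have hind : IsIndepSet G (J ∪ T) := by
    intro v hv w hw hvw
    rcases Finset.mem_union.1 hv with hv | hv <;> rcases Finset.mem_union.1 hw with hw | hw
    · obtain ⟨v, hv, rfl⟩ := Finset.mem_map.1 hv
      obtain ⟨w, hw, rfl⟩ := Finset.mem_map.1 hw
      exact hI v ‹_› w ‹_› hvw
    · exact hJS v hv (hout w hw v hvw.symm)
    · exact hJS w hw (hout v hv w hvw)
    · exact hT v hv w hw hvw
  have := card_le_indepNum hind
  rwa [Finset.card_union_of_disjoint hdisj, hJ, Finset.card_map, hcard] at this

lemma HasTriangleAdjC4.of_induce {G : SimpleGraph V} {S : Set V}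
    (h : HasTriangleAdjC4 (G.induce S)) : HasTriangleAdjC4 G := by
  obtain ⟨u, v, w, x, y, h1, h2, h3, h4, h5, h6, h7, h8⟩ := h
  exact ⟨u, v, w, x, y, h1, h2, h3, h4, h5, h6, fun e => h7 (Subtype.ext e),
    fun e => h8 (Subtype.ext e)⟩

lemma card_add_card_compl_range [Finite V] {k : ℕ} {K : SimpleGraph (Fin k)} {G : SimpleGraph V}
    (p : K ↪g G) : k + Nat.card ↥(Set.range p)ᶜ = Nat.card V := by
  rw [Nat.card_coe_set_eq, ← Set.ncard_add_ncard_compl (Set.range p),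
    ← Nat.card_coe_set_eq (Set.range p), Nat.card_range_of_injective p.injective, Nat.card_fin]

lemma numEdges_add_numEdges_compl_add_phi_le [Finite V] {W : Type} {K : SimpleGraph W}
    {G : SimpleGraph V} (p : K ↪g G) :
    numEdges K + numEdges (G.induce (Set.range p)ᶜ) + phi G (Set.range p) ≤ numEdges G := by
  set S := Set.range p
  let ι : G.induce Sᶜ ↪g G := SimpleGraph.Embedding.induce Sᶜ
  let C : Set (Sym2 V) := {e | e ∈ G.edgeSet ∧ ∃ x ∈ S, ∃ y, y ∉ S ∧ e = s(x, y)}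
  have hp : numEdges K = (Sym2.map p '' K.edgeSet).ncard := by
    rw [Set.ncard_image_of_injective _ (Sym2.map.injective p.injective)]; rfl
  have hι : numEdges (G.induce Sᶜ) = (Sym2.map ι '' (G.induce Sᶜ).edgeSet).ncard := by
    rw [Set.ncard_image_of_injective _ (Sym2.map.injective ι.injective)]; rfl
  have hC : phi G S = C.ncard := rfl
  have memp : ∀ e ∈ Sym2.map p '' K.edgeSet, e ∈ G.edgeSet ∧ ∀ x ∈ e, x ∈ S := by
    rintro _ ⟨e, he, rfl⟩
    induction e with | _ u v =>
    refine ⟨p.map_rel_iff.2 he, fun x hx => ?_⟩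
    rcases Sym2.mem_iff.1 hx with rfl | rfl <;> exact ⟨_, rfl⟩
  have memι : ∀ e ∈ Sym2.map ι '' (G.induce Sᶜ).edgeSet, e ∈ G.edgeSet ∧ ∀ x ∈ e, x ∉ S := by
    rintro _ ⟨e, he, rfl⟩
    induction e with | _ u v =>
    refine ⟨ι.map_rel_iff.2 he, fun x hx => ?_⟩
    rcases Sym2.mem_iff.1 hx with rfl | rfl
    exacts [u.2, v.2]
  have d1 : Disjoint (Sym2.map p '' K.edgeSet) (Sym2.map ι '' (G.induce Sᶜ).edgeSet) := by
    refine Set.disjoint_left.2 fun e he he' => ?_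
    induction e with | _ u v =>
    exact (memι _ he').2 u (by simp) ((memp _ he).2 u (by simp))
  have d2 : Disjoint (Sym2.map p '' K.edgeSet ∪ Sym2.map ι '' (G.induce Sᶜ).edgeSet) C := by
    refine Set.disjoint_left.2 fun e he he' => ?_
    obtain ⟨-, x, hx, y, hy, rfl⟩ := he'
    rcases he with he | he
    · exact hy ((memp _ he).2 y (by simp))
    · exact (memι _ he).2 x (by simp) hx
  rw [hp, hι, hC, ← Set.ncard_union_eq d1, ← Set.ncard_union_eq d2, numEdges,
    Nat.card_coe_set_eq]
  refine Set.ncard_le_ncard ?_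
  rintro e ((he | he) | he)
  exacts [(memp e he).1, (memι e he).1, he.1]

/-- `S` is closed under adjacency and induces a triangle or a 2-chain of triangles. -/
def IsDifficultSet (G : SimpleGraph V) (S : Set V) : Prop :=
  (∀ x ∈ S, ∀ y, G.Adj x y → y ∈ S) ∧
    ((∃ p : (⊤ : SimpleGraph (Fin 3)) ↪g G, Set.range p = S) ∨
      ∃ p : chainGraph ↪g G, Set.range p = S)

lemma nonempty_induce_iso_iff {W : Type} {K : SimpleGraph W} {G : SimpleGraph V} {S : Set V} :
    Nonempty (G.induce S ≃g K) ↔ ∃ p : K ↪g G, Set.range p = S := by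
  constructor
  · rintro ⟨φ⟩
    refine ⟨(SimpleGraph.Embedding.induce S).comp φ.symm.toEmbedding, ?_⟩
    ext x
    constructor
    · rintro ⟨i, rfl⟩
      exact (φ.symm i).2
    · intro hx
      exact ⟨φ ⟨x, hx⟩, by simp⟩
  · rintro ⟨p, rfl⟩
    refine ⟨(RelIso.mk (Equiv.ofInjective p p.injective) ?_).symm⟩
    intro i j
    exact p.map_rel_iff

lemma chainGraph_connected : chainGraph.Connected := by
  rw [SimpleGraph.connected_iff_exists_forall_reachable]
  have h2 : ∀ i, i ≠ 2 → ∃ j, chainGraph.Adj 2 j ∧ (j = i ∨ chainGraph.Adj j i) := by decide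
  refine ⟨2, fun i => ?_⟩
  by_cases hi : i = 2
  · rw [hi]
  · obtain ⟨j, hj, rfl | hji⟩ := h2 i hi
    exacts [hj.reachable, hj.reachable.trans hji.reachable]

lemma IsDifficultSet.exists_supp_eq {G : SimpleGraph V} {S : Set V} (h : IsDifficultSet G S) :
    ∃ c : G.ConnectedComponent, c.supp = S := by
  obtain ⟨hclosed, h⟩ := h
  have key : ∀ {k : ℕ} {K : SimpleGraph (Fin (k + 1))}, K.Connected → ∀ p : K ↪g G,
      Set.range p = S → ∃ c : G.ConnectedComponent, c.supp = S := by
    rintro k K hK p rfl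
    refine ⟨G.connectedComponentMk (p 0), Set.Subset.antisymm ?_ ?_⟩
    · intro x hx
      have hreach : G.Reachable (p 0) x := (SimpleGraph.ConnectedComponent.exact hx).symm
      rw [SimpleGraph.reachable_iff_reflTransGen] at hreach
      clear hx
      induction hreach with
      | refl => exact ⟨0, rfl⟩
      | tail _ hadj ih => exact hclosed _ ih _ hadj
    · rintro _ ⟨i, rfl⟩
      exact SimpleGraph.ConnectedComponent.sound ((hK i 0).map p.toHom)
  rcases h with ⟨p, hp⟩ | ⟨p, hp⟩
  · exact key SimpleGraph.connected_top p hp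
  · exact key chainGraph_connected p hp

lemma IsDifficultSet.eq_of_mem {G : SimpleGraph V} {S T : Set V} (hS : IsDifficultSet G S)
    (hT : IsDifficultSet G T) {x : V} (hxS : x ∈ S) (hxT : x ∈ T) : S = T := by
  obtain ⟨c, rfl⟩ := hS.exists_supp_eq
  obtain ⟨d, rfl⟩ := hT.exists_supp_eq
  rw [SimpleGraph.ConnectedComponent.mem_supp_iff] at hxS hxT
  rw [← hxS, ← hxT]

lemma IsDifficultSet.nonempty {G : SimpleGraph V} {S : Set V} (hS : IsDifficultSet G S) :
    S.Nonempty := by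
  obtain ⟨c, rfl⟩ := hS.exists_supp_eq
  exact c.nonempty_supp

lemma isDifficult_iff {G : SimpleGraph V} (c : G.ConnectedComponent) :
    IsDifficult G c ↔ IsDifficultSet G c.supp := by
  rw [IsDifficult, IsDifficultSet, nonempty_induce_iso_iff, nonempty_induce_iso_iff]
  refine (and_iff_right ?_).symm
  intro x hx y hxy
  rw [SimpleGraph.ConnectedComponent.mem_supp_iff] at *
  rw [← hx]
  exact (SimpleGraph.ConnectedComponent.sound hxy.reachable).symm

lemma lambda_eq_ncard (G : SimpleGraph V) : lambda G = {S | IsDifficultSet G S}.ncard := by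
  rw [lambda, ← Nat.card_coe_set_eq]
  refine Nat.card_congr (Equiv.ofBijective (fun c => ⟨c.1.supp, (isDifficult_iff c.1).1 c.2⟩)
    ⟨fun c d h => ?_, ?_⟩)
  · exact Subtype.ext (SimpleGraph.ConnectedComponent.supp_injective (congrArg Subtype.val h))
  · rintro ⟨S, hS⟩
    obtain ⟨c, rfl⟩ := IsDifficultSet.exists_supp_eq hS
    exact ⟨⟨c, (isDifficult_iff c).2 hS⟩, rfl⟩

lemma IsDifficultSet.image_val {G : SimpleGraph V} {S : Set V} {A : Set ↥Sᶜ}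
    (hA : IsDifficultSet (G.induce Sᶜ) A) (hAS : ∀ x ∈ A, ∀ s ∈ S, ¬ G.Adj x s) :
    IsDifficultSet G (Subtype.val '' A) := by
  refine ⟨?_, ?_⟩
  · rintro _ ⟨x, hx, rfl⟩ y hxy
    have hy : y ∈ Sᶜ := fun hy => hAS x hx y hy hxy
    exact ⟨⟨y, hy⟩, hA.1 x hx ⟨y, hy⟩ hxy, rfl⟩
  · refine hA.2.imp ?_ ?_ <;>
    · rintro ⟨p, rfl⟩
      exact ⟨(SimpleGraph.Embedding.induce Sᶜ).comp p, Set.range_comp Subtype.val p⟩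

/-- Deleting `S` creates at most as many difficult components as there are difficult components
of `G - S` with a neighbour in `S`. -/
lemma lambda_compl_le [Finite V] (G : SimpleGraph V) (S : Set V) :
    lambda (G.induce Sᶜ) ≤ lambda G +
      {A | IsDifficultSet (G.induce Sᶜ) A ∧ ∃ x ∈ A, ∃ s ∈ S, G.Adj x s}.ncard := by
  rw [lambda_eq_ncard, lambda_eq_ncard]
  set U := {A | IsDifficultSet (G.induce Sᶜ) A ∧ ∀ x ∈ A, ∀ s ∈ S, ¬ G.Adj x s}
  have hU : U.ncard ≤ {A | IsDifficultSet G A}.ncard :=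
    Set.ncard_le_ncard_of_injOn (fun A => Subtype.val '' A) (fun A hA => hA.1.image_val hA.2)
      (Subtype.val_injective.image_injective.injOn)
  refine le_trans (Set.ncard_le_ncard (t := U ∪ _) ?_) ((Set.ncard_union_le _ _).trans
    (Nat.add_le_add_right hU _))
  intro A hA
  by_cases h : ∃ x ∈ A, ∃ s ∈ S, G.Adj x s
  · exact Or.inr ⟨hA, h⟩
  · exact Or.inl ⟨hA, fun x hx s hs hxs => h ⟨x, hx, s, hs, hxs⟩⟩

lemma lambda_compl_le_add_phi [Finite V] (G : SimpleGraph V) (S : Set V) :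
    lambda (G.induce Sᶜ) ≤ lambda G + phi G S := by
  refine (lambda_compl_le G S).trans (Nat.add_le_add_left ?_ _)
  rw [← Nat.card_coe_set_eq]
  have hex : ∀ A : {A | IsDifficultSet (G.induce Sᶜ) A ∧ ∃ x ∈ A, ∃ s ∈ S, G.Adj x s},
      ∃ x : ↥Sᶜ, ∃ s, x ∈ A.1 ∧ s ∈ S ∧ G.Adj x s := fun ⟨_, _, x, hx, s, hs, h⟩ =>
    ⟨x, s, hx, hs, h⟩
  choose x s hx hs hadj using hex
  refine Nat.card_le_card_of_injective (fun A => (⟨s(s A, x A), (hadj A).symm, s A, hs A, x A,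
    (x A).2, rfl⟩ : {e : Sym2 V | e ∈ G.edgeSet ∧ ∃ x ∈ S, ∃ y, y ∉ S ∧ e = s(x, y)})) ?_
  intro A B hAB
  have hAB : s(s A, (x A : V)) = s(s B, (x B : V)) := congrArg Subtype.val hAB
  rcases Sym2.eq_iff.1 hAB with ⟨-, h⟩ | ⟨h, -⟩
  · have h : x A = x B := Subtype.ext h
    exact Subtype.ext (A.2.1.eq_of_mem B.2.1 (hx A) (h ▸ hx B))
  · exact absurd (h ▸ hs A) (x B).2

lemma IsDifficultSet.lambda_compl_add_one_le [Finite V] {G : SimpleGraph V} {S : Set V}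
    (hS : IsDifficultSet G S) : lambda (G.induce Sᶜ) + 1 ≤ lambda G := by
  rw [lambda_eq_ncard, lambda_eq_ncard]
  have hle : {A | IsDifficultSet (G.induce Sᶜ) A}.ncard ≤
      ({A | IsDifficultSet G A} \ {S}).ncard := by
    refine Set.ncard_le_ncard_of_injOn (fun A => Subtype.val '' A) (fun A hA => ⟨?_, ?_⟩)
      (Subtype.val_injective.image_injective.injOn)
    · exact IsDifficultSet.image_val hA fun x _ s hs hxs => x.2 (hS.1 s hs x hxs.symm)
    · intro hAS
      obtain ⟨x, hx⟩ := IsDifficultSet.nonempty hA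
      exact x.2 ((Set.mem_singleton_iff.1 hAS).subset ⟨x, hx, rfl⟩)
  have := Set.ncard_sdiff_singleton_add_one (show S ∈ {A | IsDifficultSet G A} from hS)
  omega

lemma card_le_phi [Finite V] {W : Type} {K : SimpleGraph W} {G : SimpleGraph V} (p : K ↪g G)
    (O : Finset W) (hO : ∀ i ∈ O, ∃ y, y ∉ Set.range p ∧ G.Adj (p i) y) :
    O.card ≤ phi G (Set.range p) := by
  have hex : ∀ i : O, ∃ y, y ∉ Set.range p ∧ G.Adj (p i) y := fun i => hO i i.2
  choose y hy hadj using hex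
  rw [← Fintype.card_coe, ← Nat.card_eq_fintype_card]
  refine Nat.card_le_card_of_injective (fun i => (⟨s(p i, y i), hadj i, p i, ⟨i, rfl⟩, y i, hy i,
    rfl⟩ : {e : Sym2 V | e ∈ G.edgeSet ∧ ∃ x ∈ Set.range p, ∃ y, y ∉ Set.range p ∧ e = s(x, y)})) ?_
  intro i j hij
  have hij : s(p i, y i) = s(p j, y j) := congrArg Subtype.val hij
  rcases Sym2.eq_iff.1 hij with ⟨h, -⟩ | ⟨h, -⟩
  · exact Subtype.ext (p.injective h)
  · exact absurd ⟨_, h⟩ (hy j)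

lemma indepNum_compl_range_add_card_le [Finite V] {W : Type} {K : SimpleGraph W}
    {G : SimpleGraph V} (p : K ↪g G) {T : Finset W} (hT : IsIndepSet K T)
    (hout : ∀ i ∈ T, ∀ y, G.Adj (p i) y → y ∈ Set.range p) :
    indepNum (G.induce (Set.range p)ᶜ) + T.card ≤ indepNum G := by
  have := indepNum_compl_add_card_le (G := G) (S := Set.range p) (T := T.map p.toEmbedding)
    ?_ ?_ ?_
  · rwa [Finset.card_map] at this
  · intro v hv w hw hvw
    obtain ⟨i, hi, rfl⟩ := Finset.mem_map.1 hv
    obtain ⟨j, hj, rfl⟩ := Finset.mem_map.1 hw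
    exact hT i hi j hj (p.map_rel_iff.1 hvw)
  · intro x hx
    obtain ⟨i, -, rfl⟩ := Finset.mem_map.1 hx
    exact ⟨i, rfl⟩
  · intro x hx
    obtain ⟨i, hi, rfl⟩ := Finset.mem_map.1 hx
    exact hout i hi

/-- The effect on order, size and independence number of deleting a difficult component. -/
lemma IsDifficultSet.exists_params [Finite V] {G : SimpleGraph V} {S : Set V}
    (hS : IsDifficultSet G S) : ∃ k m t : ℕ, (k = 3 ∧ m = 3 ∧ t = 1 ∨ k = 6 ∧ m = 7 ∧ t = 2) ∧
      k + Nat.card ↥Sᶜ = Nat.card V ∧ m + numEdges (G.induce Sᶜ) ≤ numEdges G ∧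
      indepNum (G.induce Sᶜ) + t ≤ indepNum G := by
  obtain ⟨hclosed, ⟨p, rfl⟩ | ⟨p, rfl⟩⟩ := hS
  · refine ⟨3, 3, 1, by simp, card_add_card_compl_range p, ?_, ?_⟩
    · have := numEdges_add_numEdges_compl_add_phi_le p
      rw [numEdges_top_fin_three] at this
      omega
    · exact indepNum_compl_range_add_card_le p (T := {0}) (by simp [IsIndepSet])
        fun i _ y h => hclosed _ ⟨i, rfl⟩ y h
  · refine ⟨6, 7, 2, by simp, card_add_card_compl_range p, ?_, ?_⟩
    · have := numEdges_add_numEdges_compl_add_phi_le p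
      rw [numEdges_chainGraph] at this
      omega
    · exact indepNum_compl_range_add_card_le p (T := {0, 4}) (by unfold IsIndepSet; decide)
        fun i _ y h => hclosed _ ⟨i, rfl⟩ y h

/-- Some triangle has, at each of its vertices, an edge leaving the triangle. -/
def HasTriangleWithExits (G : SimpleGraph V) : Prop :=
  ∃ u v w, G.Adj u v ∧ G.Adj v w ∧ G.Adj u w ∧ (∃ x, G.Adj u x ∧ x ≠ v ∧ x ≠ w) ∧
    (∃ y, G.Adj v y ∧ y ≠ u ∧ y ≠ w) ∧ ∃ z, G.Adj w z ∧ z ≠ u ∧ z ≠ v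

lemma not_hasTriangleWithExits_top : ¬ HasTriangleWithExits (⊤ : SimpleGraph (Fin 3)) := by
  unfold HasTriangleWithExits
  decide +kernel

lemma not_hasTriangleWithExits_chainGraph : ¬ HasTriangleWithExits chainGraph := by
  unfold HasTriangleWithExits
  decide +kernel

lemma IsDifficultSet.false_of_triangle_with_exits {G : SimpleGraph V} {A : Set V}
    (hA : IsDifficultSet G A) {u v w x y z : V} (hu : u ∈ A) (huv : G.Adj u v) (hvw : G.Adj v w)
    (huw : G.Adj u w) (hux : G.Adj u x) (hvy : G.Adj v y) (hwz : G.Adj w z)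
    (hx : x ≠ v ∧ x ≠ w) (hy : y ≠ u ∧ y ≠ w) (hz : z ≠ u ∧ z ≠ v) : False := by
  have hv := hA.1 u hu v huv
  have hw := hA.1 u hu w huw
  have hxA := hA.1 u hu x hux
  have hyA := hA.1 v hv y hvy
  have hzA := hA.1 w hw z hwz
  have key : ∀ {k : ℕ} {K : SimpleGraph (Fin k)} (r : K ↪g G), Set.range r = A →
      HasTriangleWithExits K := by
    rintro k K r rfl
    obtain ⟨u, rfl⟩ := hu
    obtain ⟨v, rfl⟩ := hv
    obtain ⟨w, rfl⟩ := hw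
    obtain ⟨x, rfl⟩ := hxA
    obtain ⟨y, rfl⟩ := hyA
    obtain ⟨z, rfl⟩ := hzA
    rw [r.map_adj_iff] at huv hvw huw hux hvy hwz
    rw [r.injective.ne_iff, r.injective.ne_iff] at hx hy hz
    exact ⟨u, v, w, huv, hvw, huw, ⟨x, hux, hx⟩, ⟨y, hvy, hy⟩, z, hwz, hz⟩
  obtain ⟨-, ⟨r, hr⟩ | ⟨r, hr⟩⟩ := hA
  · exact not_hasTriangleWithExits_top (key r hr)
  · exact not_hasTriangleWithExits_chainGraph (key r hr)

/-- The second triangle of the 2-chain. -/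
def rightTriangle : (⊤ : SimpleGraph (Fin 3)) ↪g chainGraph where
  toFun := ![3, 4, 5]
  inj' := by decide
  map_rel_iff' := by decide

/-- The automorphism of the 2-chain swapping its triangles. -/
def chainSwap : chainGraph ↪g chainGraph where
  toFun := Fin.rev
  inj' := Fin.rev_injective
  map_rel_iff' := by decide

/-- If all edges leaving a 2-chain start at the first triangle, with one at each of its vertices,
then the second triangle can be deleted without creating difficult components. -/
lemma exists_deletion_of_first_triangle_exits [Finite V] {G : SimpleGraph V} (p : chainGraph ↪g G)
    (hphi : phi G (Set.range p) ≤ 3)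
    (hout : ∀ i ∈ ({0, 1, 2} : Finset (Fin 6)), ∃ y, y ∉ Set.range p ∧ G.Adj (p i) y) :
    ∃ T : Set V, 3 + Nat.card ↥Tᶜ = Nat.card V ∧ numEdges (G.induce Tᶜ) + 4 ≤ numEdges G ∧
      indepNum (G.induce Tᶜ) + 1 ≤ indepNum G ∧ lambda (G.induce Tᶜ) ≤ lambda G := by
  let q : (⊤ : SimpleGraph (Fin 3)) ↪g G := p.comp rightTriangle
  have hq : ∀ i, q i = p (rightTriangle i) := fun _ => rfl
  have hmem : ∀ j, p j ∈ Set.range q ↔ ∃ i, rightTriangle i = j := fun j => by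
    simp only [Set.mem_range, hq, p.injective.eq_iff]
  have hclosed : ∀ i y, G.Adj (q i) y → ∃ j, p j = y := by
    intro i y hy
    by_contra hyp
    have hcard : ∀ i, (insert (rightTriangle i) ({0, 1, 2} : Finset (Fin 6))).card = 4 := by decide
    have := card_le_phi p (insert (rightTriangle i) {0, 1, 2}) fun j hj => by
      rcases Finset.mem_insert.1 hj with rfl | hj
      exacts [⟨y, hyp, hy⟩, hout j hj]
    rw [hcard] at this
    omega
  refine ⟨Set.range q, card_add_card_compl_range q, ?_, ?_, ?_⟩
  · have h := numEdges_add_numEdges_compl_add_phi_le q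
    have hpos := card_le_phi q {0} fun i hi => by
      rw [Finset.mem_singleton.1 hi]
      refine ⟨p 2, ?_, p.map_adj_iff.2 (by decide)⟩
      rw [hmem]
      decide
    rw [numEdges_top_fin_three] at h
    rw [Finset.card_singleton] at hpos
    omega
  · refine indepNum_compl_range_add_card_le q (T := {1}) (by simp [IsIndepSet]) fun i hi y hy => ?_
    obtain ⟨j, rfl⟩ := hclosed i y hy
    rw [Finset.mem_singleton.1 hi, hq, p.map_adj_iff] at hy
    rw [hmem]
    revert j
    decide
  · refine (lambda_compl_le G (Set.range q)).trans (le_of_eq ?_)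
    rw [Nat.add_eq_left, Set.ncard_eq_zero, Set.eq_empty_iff_forall_notMem]
    rintro A ⟨hA, x, hx, _, ⟨i, rfl⟩, hadj⟩
    obtain ⟨j, hj⟩ := hclosed i x hadj.symm
    have hxq := x.2
    rw [Set.mem_compl_iff, ← hj, hmem] at hxq
    rw [← hj, hq, p.map_adj_iff] at hadj
    have hj2 : ∀ i j, chainGraph.Adj j (rightTriangle i) → (¬ ∃ i, rightTriangle i = j) →
        j = 2 := by
      decide
    obtain rfl := hj2 i j hadj hxq
    have hleft : ∀ i ∈ ({0, 1, 2} : Finset (Fin 6)), p i ∈ (Set.range q)ᶜ := by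
      intro i hi
      rw [Set.mem_compl_iff, hmem]
      revert i
      decide
    have hsub : ∀ y, y ∉ Set.range p → y ∈ (Set.range q)ᶜ := by
      rintro y hy ⟨i, rfl⟩
      exact hy ⟨_, rfl⟩
    obtain ⟨y0, hy0, h0⟩ := hout 0 (by decide)
    obtain ⟨y1, hy1, h1⟩ := hout 1 (by decide)
    obtain ⟨y2, hy2, h2⟩ := hout 2 (by decide)
    have hne : ∀ {y : V} (hy : y ∉ Set.range p) {i : Fin 6} (hi : p i ∈ (Set.range q)ᶜ),
        (⟨y, hsub y hy⟩ : ↥(Set.range q)ᶜ) ≠ ⟨p i, hi⟩ :=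
      fun hy i _ h => hy ⟨i, (congrArg Subtype.val h).symm⟩
    have hx2 : x = ⟨p 2, hleft 2 (by decide)⟩ := Subtype.ext hj.symm
    refine hA.false_of_triangle_with_exits (u := x) (v := ⟨p 0, hleft 0 (by decide)⟩)
      (w := ⟨p 1, hleft 1 (by decide)⟩) (x := ⟨y2, hsub y2 hy2⟩) (y := ⟨y0, hsub y0 hy0⟩)
      (z := ⟨y1, hsub y1 hy1⟩) hx ?_ ?_ ?_ ?_ h0 h1 ⟨hne hy2 _, hne hy2 _⟩ ⟨?_, hne hy0 _⟩
      ⟨?_, hne hy1 _⟩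
    all_goals subst hx2
    · exact p.map_adj_iff.2 (by decide)
    · exact p.map_adj_iff.2 (by decide)
    · exact p.map_adj_iff.2 (by decide)
    · exact h2
    · exact hne hy0 _
    · exact hne hy1 _

/-- The lower bound on the independence number that a minimal counterexample violates. -/
def SatisfiesBound (a b : ℝ) (G : SimpleGraph V) : Prop :=
  (indepNum G : ℝ) ≥ (Nat.card V : ℝ) - (a * Nat.card V + b * numEdges G + b * lambda G)

lemma SatisfiesBound.of_deletion {a b : ℝ} (hb : 0 < b) {W : Type} {G : SimpleGraph V}
    {G' : SimpleGraph W} (h : SatisfiesBound a b G') {k m t : ℕ}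
    (hcard : k + Nat.card W = Nat.card V)
    (hindep : indepNum G' + t ≤ indepNum G)
    (hedges : numEdges G' + lambda G' + m ≤ numEdges G + lambda G)
    (hkmt : (k : ℝ) ≤ a * k + b * m + t) : SatisfiesBound a b G := by
  unfold SatisfiesBound at *
  have hcard : (k : ℝ) + Nat.card W = Nat.card V := by exact_mod_cast hcard
  have hindep : (indepNum G' : ℝ) + t ≤ indepNum G := by exact_mod_cast hindep
  have hedges : (numEdges G' : ℝ) + lambda G' + m ≤ numEdges G + lambda G := by
    exact_mod_cast hedges
  have := mul_le_mul_of_nonneg_left hedges hb.le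
  rw [← hcard]
  linarith

lemma exists_nonadj_of_card_le_three : ∀ O : Finset (Fin 6), O.card ≤ 3 →
    ¬ {0, 1, 2} ⊆ O → ¬ {3, 4, 5} ⊆ O →
    ∃ i j, i ≠ j ∧ i ∉ O ∧ j ∉ O ∧ ¬ chainGraph.Adj i j := by
  decide +kernel

lemma satisfiesBound_of_chain {a b : ℝ} (hb : 0 < b) (h3 : 9 * a + 11 * b ≥ 6)
    [Finite V] {G : SimpleGraph V}
    (hdel : ∀ (W : Type) [Fintype W] (G' : SimpleGraph W), Nat.card W < Nat.card V →
      ¬ HasTriangleAdjC4 G' → SatisfiesBound a b G')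
    (hG : ¬ HasTriangleAdjC4 G) (p : chainGraph ↪g G) (hphi : phi G (Set.range p) ≤ 3) :
    SatisfiesBound a b G := by
  classical
  have hinduce : ∀ S : Set V, Nat.card ↥Sᶜ < Nat.card V → SatisfiesBound a b (G.induce Sᶜ) :=
    fun S hS => by
      have := Fintype.ofFinite ↥Sᶜ
      exact hdel _ _ hS fun h => hG h.of_induce
  have hbad : ∀ r : chainGraph ↪g G, Set.range r = Set.range p →
      (∀ i ∈ ({0, 1, 2} : Finset (Fin 6)), ∃ y, y ∉ Set.range r ∧ G.Adj (r i) y) →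
      SatisfiesBound a b G := by
    intro r hr hout
    obtain ⟨T, hcard, hedges, hindep, hlam⟩ :=
      exists_deletion_of_first_triangle_exits r (hr ▸ hphi) hout
    refine (hinduce T (by omega)).of_deletion hb (k := 3) (m := 4) (t := 1) hcard hindep
      (by omega) ?_
    push_cast
    linarith
  set O : Finset (Fin 6) := {i | ∃ y, y ∉ Set.range p ∧ G.Adj (p i) y} with hO
  have hmemO : ∀ {i}, i ∈ O ↔ ∃ y, y ∉ Set.range p ∧ G.Adj (p i) y := by simp [hO]
  by_cases hleft : {0, 1, 2} ⊆ O
  · exact hbad p rfl fun i hi => hmemO.1 (hleft hi)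
  by_cases hright : {3, 4, 5} ⊆ O
  · have hrange : Set.range (p.comp chainSwap) = Set.range p :=
      Fin.rev_surjective.range_comp p
    refine hbad (p.comp chainSwap) hrange fun i hi => ?_
    rw [hrange]
    refine hmemO.1 (hright (?_ : Fin.rev i ∈ _))
    revert i
    decide
  obtain ⟨i, j, hij, hi, hj, hnadj⟩ := exists_nonadj_of_card_le_three O
    ((card_le_phi p O fun i hi => hmemO.1 hi).trans hphi) hleft hright
  have hindep := indepNum_compl_range_add_card_le p (T := {i, j}) (by
      have := mt SimpleGraph.Adj.symm hnadj
      simp_all [IsIndepSet]) fun l hl y hy => by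
    by_contra hyp
    have : l ∈ O := hmemO.2 ⟨y, hyp, hy⟩
    rcases Finset.mem_insert.1 hl with rfl | hl
    · exact hi this
    · exact hj (Finset.mem_singleton.1 hl ▸ this)
  rw [Finset.card_pair hij] at hindep
  have hcard := card_add_card_compl_range p
  have hedges := numEdges_add_numEdges_compl_add_phi_le p
  rw [numEdges_chainGraph] at hedges
  have hlam := lambda_compl_le_add_phi G (Set.range p)
  have hbound := hinduce (Set.range p) (by omega)
  by_cases hgain : numEdges (G.induce (Set.range p)ᶜ) + lambda (G.induce (Set.range p)ᶜ) + 8 ≤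
      numEdges G + lambda G
  · refine hbound.of_deletion hb hcard hindep hgain ?_
    push_cast
    linarith
  have hpos : 0 < phi G (Set.range p) := by
    by_contra hzero
    have hdiff : IsDifficultSet G (Set.range p) := by
      refine ⟨?_, Or.inr ⟨p, rfl⟩⟩
      rintro _ ⟨i, rfl⟩ y hy
      by_contra hyp
      have := card_le_phi p {i} fun l hl => by
        rw [Finset.mem_singleton.1 hl]
        exact ⟨y, hyp, hy⟩
      rw [Finset.card_singleton] at this
      omega
    have := hdiff.lambda_compl_add_one_le
    omega
  obtain ⟨D, hD⟩ : ∃ D, IsDifficultSet (G.induce (Set.range p)ᶜ) D := by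
    have : lambda (G.induce (Set.range p)ᶜ) ≠ 0 := by omega
    rw [lambda_eq_ncard] at this
    exact Set.nonempty_of_ncard_ne_zero this
  obtain ⟨k, m, t, hkmt, hcardD, hedgesD, hindepD⟩ := hD.exists_params
  have hlamD := hD.lambda_compl_add_one_le
  have := Fintype.ofFinite ↥Dᶜ
  have hboundD := hdel _ ((G.induce (Set.range p)ᶜ).induce Dᶜ) (by omega)
    fun h => hG h.of_induce.of_induce
  refine hboundD.of_deletion hb (k := 6 + k) (m := 8 + m) (t := 2 + t) (by omega) (by omega)
    (by omega) ?_
  rcases hkmt with ⟨rfl, rfl, rfl⟩ | ⟨rfl, rfl, rfl⟩ <;>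
  · push_cast
    linarith

end General


/-- Claim 2.7: every induced 2-chain of triangles H satisfies Φ(H) ≥ 4. -/
theorem claim_two_chain_edges_leaving
(a b : ℝ) (ha : 0 < a) (hb : 0 < b)
    (h1 : 2 * a + b ≥ 1) (h2 : 3 * a + 4 * b ≥ 2) (h3 : 9 * a + 11 * b ≥ 6)
    (h4 : a + 5 * b ≥ 1) (h5 : 4 * a + 9 * b ≥ 3) (h6 : 10 * a + 16 * b ≥ 7)
    (h7 : 13 * a + 20 * b ≥ 8) (h8 : 5 * a + 14 * b ≥ 4)
    (h9 : a + (3 / 2) * b ≥ 2 / 3)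
{V : Type} [Fintype V] (G : SimpleGraph V)
    (hG : ¬ HasTriangleAdjC4 G)
    (hcex : (indepNum G : ℝ) <
      (Nat.card V : ℝ) - (a * Nat.card V + b * numEdges G + b * lambda G))
    (hmin : ∀ (W : Type) [Fintype W] (G' : SimpleGraph W),
      Nat.card W < Nat.card V → ¬ HasTriangleAdjC4 G' →
      (indepNum G' : ℝ) ≥
        (Nat.card W : ℝ) - (a * Nat.card W + b * numEdges G' + b * lambda G')) :
    ∀ S : Set V, Nonempty (SimpleGraph.induce S G ≃g chainGraph) →
      4 ≤ phi G S := by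
  rintro S hS
  obtain ⟨p, rfl⟩ := nonempty_induce_iso_iff.1 hS
  by_contra hphi
  exact hcex.not_ge (satisfiesBound_of_chain hb h3 hmin hG p (by omega))

end Paper
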